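/- Let y = φ(x, u, u_[1], …, u_[q]) be a flat output of a flat discrete-time system x⁺ = f(x,u) with parametrization x = F_x(y_[0,R−1]), u = F_u(y_[0,R]). Then there is a one-to-one correspondence between solutions of the system and arbitrary trajectories of the flat output: for every trajectory y(k) = (y¹(k),…,y^m(k)) of the flat output there exists a uniquely determined solution (x(k), u(k)) of x(k+1) = f(x(k), u(k)) such that y^j(k) = φ^j(x(k), u(k), u(k+1), …, u(k+q)) holds identically for j = 1,…,m; the trajectories x(k) and u(k) are determined by y(k) and its forward-shifts via x(k) = F_x(y_[0,R−1](k)) and u(k) = F_u(y_[0,R](k)). -/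

import Mathlib

/-!
Discrete-time systems `x⁺ = f(x,u)` and difference flatness, following
Kolar–Schöberl–Diwold, "Differential-Geometric Decomposition of Flat Nonlinear
Discrete-Time Systems".
-/

open Filter Topology Function

noncomputable section

/-- The forward-shift operator `δ_{xu}` on the space with coordinates
`(x, u, u_[1], u_[2], …)`: a point `(x, (u, u_[1], …))` is sent to
`(f(x,u), (u_[1], u_[2], …))`.  Composing functions with this map realizes the
forward shift of functions. -/
def shift {X U : Type*} (f : X → U → X) : X × (ℕ → U) → X × (ℕ → U) :=
  fun p => (f p.1 (p.2 0), fun k => p.2 (k + 1))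

/-- `φ` is a smooth function `φ(x, u, u_[1], …, u_[q])` of the state and finitely
many forward-shifts of the input. -/
def SmoothFiniteDep {X U Y : Type*} [NormedAddCommGroup X] [NormedSpace ℝ X]
    [NormedAddCommGroup U] [NormedSpace ℝ U] [NormedAddCommGroup Y] [NormedSpace ℝ Y]
    (φ : X × (ℕ → U) → Y) : Prop :=
  ∃ (q : ℕ) (ψ : X × (Fin (q + 1) → U) → Y),
    ContDiff ℝ (⊤ : ℕ∞) ψ ∧ ∀ p, φ p = ψ (p.1, fun k => p.2 k)

/-- `φ` is a flat output of the system `x⁺ = f(x,u)` around `(x₀,u₀)`: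
it is a smooth function of `(x, u, u_[1], …, u_[q])`, and locally around the
point `(x₀, (u₀, u₀, …))` the state `x` and the input `u` can be expressed as a
(smooth) function `E` of `φ` and finitely many of its forward shifts
`φ ∘ δ_{xu}^α`. -/
def IsFlatOutput {X U Y : Type*} [NormedAddCommGroup X] [NormedSpace ℝ X]
    [NormedAddCommGroup U] [NormedSpace ℝ U] [NormedAddCommGroup Y] [NormedSpace ℝ Y]
    (f : X → U → X) (x₀ : X) (u₀ : U) (φ : X × (ℕ → U) → Y) : Prop :=
  SmoothFiniteDep φ ∧
  ∃ (N : ℕ) (E : (Fin N → Y) → X × U), ContDiff ℝ (⊤ : ℕ∞) E ∧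
    ∀ᶠ p in 𝓝 ((x₀, fun _ => u₀) : X × (ℕ → U)),
      E (fun α => φ ((shift f)^[(α : ℕ)] p)) = (p.1, p.2 0)

/-- The system `x⁺ = f(x,u)` is flat around `(x₀,u₀)` if it possesses a flat
output (an `m`-tuple of functions, i.e. a function valued in the input space). -/
def IsFlat {X U : Type*} [NormedAddCommGroup X] [NormedSpace ℝ X]
    [NormedAddCommGroup U] [NormedSpace ℝ U]
    (f : X → U → X) (x₀ : X) (u₀ : U) : Prop :=
  ∃ φ : X × (ℕ → U) → U, IsFlatOutput f x₀ u₀ φ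

/-- Over a commutative domain, a finite family whose span contains a linearly independent family
of the same cardinality is linearly independent. -/
theorem LinearIndependent.of_mem_span_range {R M ι : Type*} [CommRing R] [IsDomain R]
    [AddCommGroup M] [Module R M] [Fintype ι] {u c : ι → M} (hu : LinearIndependent R u)
    (h : ∀ i, u i ∈ Submodule.span R (Set.range c)) : LinearIndependent R c := by
  rw [linearIndependent_iff_card_le_finrank_span, ← finrank_span_eq_card hu]
  have := Module.Finite.span_of_finite R (Set.finite_range c)
  exact Submodule.finrank_mono (Submodule.span_le.2 (by rintro _ ⟨i, rfl⟩; exact h i))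

theorem aeval_dualMap_apply {V : Type*} [AddCommGroup V] [Module ℝ V] (T : V →ₗ[ℝ] V)
    (p : Polynomial ℝ) (ξ : Module.Dual ℝ V) (v : V) :
    Polynomial.aeval T.dualMap p ξ v = ξ (Polynomial.aeval T p v) := by
  induction p using Polynomial.induction_on' with
  | add p q hp hq => simp only [map_add, LinearMap.add_apply, hp, hq]
  | monomial k a =>
    have hpow : ∀ (k : ℕ) (ξ : Module.Dual ℝ V), (T.dualMap ^ k) ξ = ξ ∘ₗ T ^ k := by
      intro k
      induction k with
      | zero => intro ξ; rfl
      | succ k ih =>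
        intro ξ
        rw [pow_succ, Module.End.mul_apply, ih, pow_succ']
        rfl
    simp [Polynomial.aeval_monomial, hpow]

/-- If the shifted outputs `C (T ^ α v)` determine the input, then the outputs
`C`, `C ∘ T`, …, `C ∘ T ^ (K - 1)` are independent. -/
theorem surjective_shifted_outputs {X : Type*} [AddCommGroup X] [Module ℝ X] {m : ℕ}
    (T : X × (ℕ → Fin m → ℝ) →ₗ[ℝ] X × (ℕ → Fin m → ℝ))
    (C : X × (ℕ → Fin m → ℝ) →ₗ[ℝ] (Fin m → ℝ))
    (hT : ∀ v i, (T v).2 i = v.2 (i + 1)) {N : ℕ}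
    (G : (Fin N → Fin m → ℝ) →ₗ[ℝ] (Fin m → ℝ))
    (hG : ∀ v, (G fun α => C ((T ^ (α : ℕ)) v)) = v.2 0) (K : ℕ) :
    Surjective (LinearMap.pi fun α : Fin K => C ∘ₗ T ^ (α : ℕ)) := by
  have hTpow : ∀ (k : ℕ) v i, ((T ^ k) v).2 i = v.2 (i + k) := by
    intro k
    induction k with
    | zero => intro v i; rfl
    | succ k ih => intro v i; rw [pow_succ, Module.End.mul_apply, ih, hT]; rfl
  let _ : Module (Polynomial ℝ) (Module.Dual ℝ (X × (ℕ → Fin m → ℝ))) :=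
    Module.compHom _ (Polynomial.aeval T.dualMap).toRingHom
  have smul_apply : ∀ (p : Polynomial ℝ) (ξ : Module.Dual ℝ (X × (ℕ → Fin m → ℝ))) v,
      (p • ξ) v = ξ (Polynomial.aeval T p v) := aeval_dualMap_apply T
  have : IsScalarTower ℝ (Polynomial ℝ) (Module.Dual ℝ (X × (ℕ → Fin m → ℝ))) :=
    ⟨fun r p ξ => by refine LinearMap.ext fun v => ?_; simp only [smul_apply, LinearMap.smul_apply, map_smul]⟩
  have sum_apply : ∀ (l : Fin m → ℝ) (L : (Fin m → ℝ) →ₗ[ℝ] ℝ),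
      L l = ∑ i, L (Pi.single i 1) * l i := by
    intro l L
    conv_lhs => rw [← Finset.univ_sum_single l, map_sum]
    refine Finset.sum_congr rfl fun i _ => ?_
    rw [mul_comm, ← smul_eq_mul, ← map_smul, ← Pi.single_smul, smul_eq_mul, mul_one]
  have sum_sum_apply : ∀ {N : ℕ} (L : (Fin N → Fin m → ℝ) →ₗ[ℝ] ℝ) z,
      L z = ∑ α, ∑ i, L (Pi.single α (Pi.single i 1)) * z α i := by
    intro N L z
    conv_lhs => rw [← Finset.univ_sum_single z, map_sum]
    exact Finset.sum_congr rfl fun α _ =>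
      sum_apply (z α) (L ∘ₗ LinearMap.single ℝ (fun _ => Fin m → ℝ) α)
  let u : Fin m → Module.Dual ℝ (X × (ℕ → Fin m → ℝ)) := fun j =>
    LinearMap.proj j ∘ₗ LinearMap.proj 0 ∘ₗ LinearMap.snd ℝ X (ℕ → Fin m → ℝ)
  let c : Fin m → Module.Dual ℝ (X × (ℕ → Fin m → ℝ)) := fun j => LinearMap.proj j ∘ₗ C
  have hu : LinearIndependent (Polynomial ℝ) u := by
    rw [Fintype.linearIndependent_iff]
    intro g hg j
    ext k
    have h := congrArg (fun w => w ((0, Pi.single k (Pi.single j 1)) :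
      X × (ℕ → Fin m → ℝ))) hg
    simp only [LinearMap.sum_apply, u, smul_apply,
      Polynomial.aeval_eq_sum_range, LinearMap.zero_apply] at h
    simp only [LinearMap.comp_apply, LinearMap.proj_apply, LinearMap.snd_apply,
      LinearMap.smul_apply, Prod.snd_sum, Finset.sum_apply, Prod.smul_snd,
      Pi.smul_apply, hTpow, Pi.single_apply, zero_add, smul_eq_mul] at h
    rw [Finset.sum_eq_single j, Finset.sum_eq_single k] at h
    · simpa using h
    · intro b _ hb; simp [hb]
    · intro hk
      rw [Finset.mem_range, not_lt] at hk
      rw [Polynomial.coeff_eq_zero_of_natDegree_lt (by omega), zero_mul]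
    · intro b _ hb
      refine Finset.sum_eq_zero fun i _ => ?_
      split_ifs <;> simp [hb]
    · simp
  have hc : LinearIndependent (Polynomial ℝ) c := by
    refine hu.of_mem_span_range fun j => ?_
    have : u j = ∑ α : Fin N, ∑ i : Fin m,
        Polynomial.monomial (α : ℕ) (G (Pi.single α (Pi.single i 1)) j) • c i := by
      refine LinearMap.ext fun v => ?_
      have h := sum_sum_apply (LinearMap.proj j ∘ₗ G) fun α => C ((T ^ (α : ℕ)) v)
      simp only [LinearMap.comp_apply, hG] at h
      simp only [LinearMap.sum_apply, smul_apply, Polynomial.aeval_monomial]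
      simpa [u, c] using h
    rw [this]
    exact Submodule.sum_mem _ fun α _ => Submodule.sum_mem _ fun i _ =>
      Submodule.smul_mem _ _ (Submodule.subset_span ⟨i, rfl⟩)
  rw [← LinearMap.dualMap_injective_iff, injective_iff_map_eq_zero]
  intro l hl
  have hli := (linearIndependent_smul (R := ℝ)
    (Polynomial.basisMonomials ℝ).linearIndependent hc).comp
      (fun p : Fin K × Fin m => ((p.1 : ℕ), p.2)) (by
        rintro ⟨a, b⟩ ⟨a', b'⟩ h
        simpa [Fin.ext_iff] using h)
  rw [Fintype.linearIndependent_iff] at hli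
  have hzero := hli (fun p => l (Pi.single p.1 (Pi.single p.2 1))) (by
    refine LinearMap.ext fun v => ?_
    have h := LinearMap.congr_fun hl v
    rw [LinearMap.dualMap_apply, sum_sum_apply l, ← Fintype.sum_prod_type'] at h
    rw [← h]
    simp only [LinearMap.sum_apply, LinearMap.smul_apply, Function.comp_apply, smul_apply,
      Polynomial.coe_basisMonomials, Polynomial.aeval_monomial]
    simp [c])
  refine LinearMap.ext fun z => ?_
  rw [sum_sum_apply l]
  exact Finset.sum_eq_zero fun α _ => Finset.sum_eq_zero fun i _ => by simp [hzero (α, i)]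

section Linearization

variable {X U W : Type*} [NormedAddCommGroup X] [NormedSpace ℝ X]
  [NormedAddCommGroup U] [NormedSpace ℝ U] [NormedAddCommGroup W] [NormedSpace ℝ W]

/-- The linearization of `shift f` at a point where `f` has derivative `A`. -/
def shiftLinear (A : X × U →L[ℝ] X) : X × (ℕ → U) →L[ℝ] X × (ℕ → U) :=
  (A ∘L (ContinuousLinearMap.fst ℝ X (ℕ → U)).prod
      (ContinuousLinearMap.proj 0 ∘L ContinuousLinearMap.snd ℝ X (ℕ → U))).prod
    (ContinuousLinearMap.pi fun k =>
      ContinuousLinearMap.proj (k + 1) ∘L ContinuousLinearMap.snd ℝ X (ℕ → U))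

/-- Strict differentiability, coordinate by coordinate, of a map into the space with coordinates
`(x, u, u_[1], …)`. -/
def HasCoordFDerivAt (g : W → X × (ℕ → U)) (g' : W →L[ℝ] X × (ℕ → U)) (w : W) : Prop :=
  HasStrictFDerivAt (fun z => (g z).1) (ContinuousLinearMap.fst ℝ X (ℕ → U) ∘L g') w ∧
  ∀ i, HasStrictFDerivAt (fun z => (g z).2 i)
    (ContinuousLinearMap.proj i ∘L ContinuousLinearMap.snd ℝ X (ℕ → U) ∘L g') w

theorem hasCoordFDerivAt_const_add (p : X × (ℕ → U)) (σ : W →L[ℝ] X × (ℕ → U)) (w : W) :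
    HasCoordFDerivAt (fun z => p + σ z) σ w :=
  ⟨(ContinuousLinearMap.fst ℝ X (ℕ → U) ∘L σ).hasStrictFDerivAt.const_add p.1,
    fun i => (ContinuousLinearMap.proj i ∘L ContinuousLinearMap.snd ℝ X (ℕ → U) ∘L
      σ).hasStrictFDerivAt.const_add (p.2 i)⟩

theorem HasCoordFDerivAt.shift {f : X → U → X} {A : X × U →L[ℝ] X} {g : W → X × (ℕ → U)}
    {g' : W →L[ℝ] X × (ℕ → U)} {w : W}
    (hf : HasStrictFDerivAt (fun p : X × U => f p.1 p.2) A ((g w).1, (g w).2 0))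
    (hg : HasCoordFDerivAt g g' w) :
    HasCoordFDerivAt (fun z => shift f (g z)) (shiftLinear A ∘L g') w :=
  ⟨hf.comp w (hg.1.prodMk (hg.2 0)), fun i => hg.2 (i + 1)⟩

theorem HasCoordFDerivAt.iterate_shift {f : X → U → X} {A : X × U →L[ℝ] X}
    {g : W → X × (ℕ → U)} {g' : W →L[ℝ] X × (ℕ → U)} {w : W}
    (hf : HasStrictFDerivAt (fun p : X × U => f p.1 p.2) A ((g w).1, (g w).2 0))
    (hfix : _root_.shift f (g w) = g w) (hg : HasCoordFDerivAt g g' w) (α : ℕ) :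
    HasCoordFDerivAt (fun z => (_root_.shift f)^[α] (g z)) ((shiftLinear A ^ α) ∘L g') w := by
  induction α with
  | zero => exact hg
  | succ α ih =>
    have hw : (_root_.shift f)^[α] (g w) = g w := iterate_fixed hfix α
    have h := HasCoordFDerivAt.shift (g := fun z => (_root_.shift f)^[α] (g z)) (f := f) (A := A)
      (by simpa only [hw] using hf) ih
    simp only [iterate_succ_apply']
    rwa [pow_succ']

/-- A smooth function of finitely many coordinates has a linearization at every point. -/
theorem SmoothFiniteDep.exists_linearization {Y : Type*} [NormedAddCommGroup Y] [NormedSpace ℝ Y]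
    {φ : X × (ℕ → U) → Y} (hφ : SmoothFiniteDep φ) (p : X × (ℕ → U)) :
    ∃ C : X × (ℕ → U) →L[ℝ] Y, ∀ {W : Type} [NormedAddCommGroup W] [NormedSpace ℝ W]
      (g : W → X × (ℕ → U)) (g' : W →L[ℝ] X × (ℕ → U)) (w : W),
      g w = p → HasCoordFDerivAt g g' w → HasStrictFDerivAt (fun z => φ (g z)) (C ∘L g') w := by
  obtain ⟨q, ψ, hψ, hφψ⟩ := hφ
  refine ⟨fderiv ℝ ψ (p.1, fun k => p.2 k) ∘L (ContinuousLinearMap.fst ℝ X (ℕ → U)).prod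
    (ContinuousLinearMap.pi fun k : Fin (q + 1) =>
      ContinuousLinearMap.proj (k : ℕ) ∘L ContinuousLinearMap.snd ℝ X (ℕ → U)), ?_⟩
  rintro W _ _ g g' w rfl hg
  simp only [hφψ]
  have hpi := hasStrictFDerivAt_pi.2 fun k : Fin (q + 1) => hg.2 k
  exact (hψ.contDiffAt.hasStrictFDerivAt (by simp)).comp w (hg.1.prodMk hpi)

end Linearization

theorem shift_fixed {X U : Type*} {f : X → U → X} {x₀ : X} {u₀ : U} (heq : x₀ = f x₀ u₀) :
    shift f (x₀, fun _ => u₀) = (x₀, fun _ => u₀) :=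
  Prod.ext heq.symm rfl

theorem snd_iterate_shift {X U : Type*} (f : X → U → X) (p : X × (ℕ → U)) (i k : ℕ) :
    ((shift f)^[i] p).2 k = p.2 (k + i) := by
  induction i generalizing k with
  | zero => rfl
  | succ i ih =>
    rw [iterate_succ_apply']
    exact (ih (k + 1)).trans (congrArg p.2 (by omega))

theorem continuous_shift {X U : Type*} [TopologicalSpace X] [TopologicalSpace U] {f : X → U → X}
    (hf : Continuous fun p : X × U => f p.1 p.2) : Continuous (shift f) :=
  (hf.comp (continuous_fst.prodMk ((continuous_apply 0).comp continuous_snd))).prodMk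
    (continuous_pi fun k => (continuous_apply (k + 1)).comp continuous_snd)

/-- A flat output and finitely many of its forward shifts can take arbitrary values near the
equilibrium, at points close to the equilibrium. -/
theorem IsFlatOutput.eventually_exists_jet {X : Type*} [NormedAddCommGroup X] [NormedSpace ℝ X]
    {m : ℕ} {f : X → (Fin m → ℝ) → X}
    (hf : ContDiff ℝ (⊤ : ℕ∞) fun p : X × (Fin m → ℝ) => f p.1 p.2)
    {x₀ : X} {u₀ : Fin m → ℝ} (heq : x₀ = f x₀ u₀) {φ : X × (ℕ → Fin m → ℝ) → (Fin m → ℝ)}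
    (hflat : IsFlatOutput f x₀ u₀ φ) {S : Set (X × (ℕ → Fin m → ℝ))}
    (hS : S ∈ 𝓝 ((x₀, fun _ => u₀) : X × (ℕ → Fin m → ℝ))) (K : ℕ) :
    ∀ᶠ z in 𝓝 (fun _ : Fin K => φ (x₀, fun _ => u₀)),
      ∃ p ∈ S, ∀ α : Fin K, φ ((shift f)^[(α : ℕ)] p) = z α := by
  obtain ⟨hφ, N, E, hE, hEp⟩ := hflat
  set p₀ : X × (ℕ → Fin m → ℝ) := (x₀, fun _ => u₀)
  have hfix : ∀ α : ℕ, (shift f)^[α] p₀ = p₀ := iterate_fixed (shift_fixed heq)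
  obtain ⟨C, hC⟩ := hφ.exists_linearization p₀
  set A := fderiv ℝ (fun p : X × (Fin m → ℝ) => f p.1 p.2) (x₀, u₀)
  have hA : HasStrictFDerivAt (fun p : X × (Fin m → ℝ) => f p.1 p.2) A (x₀, u₀) :=
    hf.contDiffAt.hasStrictFDerivAt (by simp)
  set T := shiftLinear A
  have hjet : ∀ {W : Type} [NormedAddCommGroup W] [NormedSpace ℝ W]
      (σ : W →L[ℝ] X × (ℕ → Fin m → ℝ)) (α : ℕ),
      HasStrictFDerivAt (fun z => φ ((shift f)^[α] (p₀ + σ z))) (C ∘L (T ^ α) ∘L σ) 0 := by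
    intro W _ _ σ α
    refine hC _ _ 0 (by simp [hfix]) ?_
    exact (hasCoordFDerivAt_const_add p₀ σ 0).iterate_shift (by simpa [p₀] using hA)
      (by simpa using hfix 1) α
  have hpow : ∀ (α : ℕ) v, ((T : X × (ℕ → Fin m → ℝ) →ₗ[ℝ] X × (ℕ → Fin m → ℝ)) ^ α) v
      = (T ^ α) v := by
    intro α v
    rw [← ContinuousLinearMap.toLinearMap_pow]
    rfl
  have hsurj := surjective_shifted_outputs (T : X × (ℕ → Fin m → ℝ) →ₗ[ℝ] X × (ℕ → Fin m → ℝ))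
    (C : X × (ℕ → Fin m → ℝ) →ₗ[ℝ] (Fin m → ℝ)) (fun _ _ => rfl)
    (N := N) (LinearMap.snd ℝ X (Fin m → ℝ) ∘ₗ
      (fderiv ℝ E fun _ => φ p₀ : (Fin N → Fin m → ℝ) →ₗ[ℝ] X × (Fin m → ℝ)))
    (by
      intro v
      let σ : ℝ →L[ℝ] X × (ℕ → Fin m → ℝ) := ContinuousLinearMap.toSpanSingleton ℝ v
      have hcont : Tendsto (fun s : ℝ => p₀ + σ s) (𝓝 0) (𝓝 p₀) := by
        have : Continuous fun s : ℝ => p₀ + σ s := continuous_const.add σ.continuous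
        simpa using this.tendsto 0
      have hE' : HasStrictFDerivAt E (fderiv ℝ E fun _ => φ p₀)
          (fun α : Fin N => φ ((shift f)^[(α : ℕ)] (p₀ + σ 0))) := by
        simpa [hfix] using hE.contDiffAt.hasStrictFDerivAt (x := fun _ : Fin N => φ p₀) (by simp)
      have h₁ := (hE'.comp (0 : ℝ)
        (hasStrictFDerivAt_pi.2 fun α : Fin N => hjet σ α)).hasFDerivAt
      have h₂ := hasCoordFDerivAt_const_add p₀ σ 0
      have h₃ := (h₂.1.prodMk (h₂.2 0)).hasFDerivAt.congr_of_eventuallyEq (hcont.eventually hEp)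
      have h := congrArg Prod.snd (DFunLike.congr_fun (h₁.unique h₃) 1)
      simpa [σ, hpow] using h) K
  obtain ⟨σ, hσ⟩ := LinearMap.exists_rightInverse_of_surjective _ (LinearMap.range_eq_top.2 hsurj)
  let σ' : (Fin K → Fin m → ℝ) →L[ℝ] X × (ℕ → Fin m → ℝ) := LinearMap.toContinuousLinearMap σ
  have hG := hasStrictFDerivAt_pi.2 fun α : Fin K => hjet σ' α
  have hopen := hG.map_nhds_eq_of_surj (by
    refine LinearMap.range_eq_top.2 fun z => ⟨z, ?_⟩
    have h := LinearMap.congr_fun hσ z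
    ext α : 1
    simpa [hpow, σ'] using congrFun h α)
  have hcont : Tendsto (fun z => p₀ + σ' z) (𝓝 0) (𝓝 p₀) := by
    have : Continuous fun z => p₀ + σ' z := continuous_const.add σ'.continuous
    simpa using this.tendsto 0
  simp only [map_zero, add_zero, hfix] at hopen
  rw [← hopen, eventually_map]
  filter_upwards [hcont.eventually_mem hS] with z hz
  exact ⟨_, hz, fun _ => rfl⟩

/-- A neighbourhood of a constant sequence contains all sequences staying close to the constant. -/
theorem exists_nhds_forall_of_eventually_nhds_const {Y : Type*} [TopologicalSpace Y] {y₀ : Y}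
    {P : (ℕ → Y) → Prop} (hP : ∀ᶠ z in 𝓝 (fun _ : ℕ => y₀), P z) :
    ∃ V ∈ 𝓝 y₀, ∀ z : ℕ → Y, (∀ k, z k ∈ V) → P z := by
  rw [nhds_pi, Filter.Eventually, Filter.mem_pi] at hP
  obtain ⟨I, hI, t, ht, hsub⟩ := hP
  exact ⟨⋂ i ∈ I, t i, (biInter_mem hI).2 fun i _ => ht i,
    fun z hz => hsub fun i hi => Set.mem_iInter₂.1 (hz i) i hi⟩

/-- Let `y = φ` be a flat output of `x⁺ = f(x,u)` with
parametrization `x = F_x(y_[0,R−1])`, `u = F_u(y_[0,R])`.  Then there is a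
one-to-one correspondence between solutions of the system and (locally
arbitrary) trajectories of the flat output: for every trajectory `Y(k)` of the
flat output (staying in a suitable neighbourhood `Z` of the equilibrium jet
values) there is a unique solution `(x(k),u(k))` (staying in a suitable
neighbourhood `S`) with `Y(k) = φ(x(k),u(k),u(k+1),…)` for all `k`, and it is
given by `x(k) = F_x(y_[0,R−1](k))`, `u(k) = F_u(y_[0,R](k))`. -/
theorem solutions_correspond_to_flat_output_trajectories {n m : ℕ}
    (f : (Fin n → ℝ) → (Fin m → ℝ) → (Fin n → ℝ))
    (hf : ContDiff ℝ (⊤ : ℕ∞) fun p : (Fin n → ℝ) × (Fin m → ℝ) => f p.1 p.2)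
    (hsub : ∀ x u, Function.Surjective
      (fderiv ℝ (fun p : (Fin n → ℝ) × (Fin m → ℝ) => f p.1 p.2) (x, u)))
    (x₀ : Fin n → ℝ) (u₀ : Fin m → ℝ) (heq : x₀ = f x₀ u₀)
    (φ : (Fin n → ℝ) × (ℕ → Fin m → ℝ) → (Fin m → ℝ))
    (hflat : IsFlatOutput f x₀ u₀ φ)
    (R : Fin m → ℕ)
    (Fx : ((j : Fin m) → Fin (R j) → ℝ) → (Fin n → ℝ))
    (Fu : ((j : Fin m) → Fin (R j + 1) → ℝ) → (Fin m → ℝ))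
    (hFx : ContDiff ℝ (⊤ : ℕ∞) Fx) (hFu : ContDiff ℝ (⊤ : ℕ∞) Fu)
    (hpar : ∀ᶠ p in 𝓝 ((x₀, fun _ => u₀) : (Fin n → ℝ) × (ℕ → Fin m → ℝ)),
      Fx (fun j (α : Fin (R j)) => φ ((shift f)^[(α : ℕ)] p) j) = p.1 ∧
      Fu (fun j (α : Fin (R j + 1)) => φ ((shift f)^[(α : ℕ)] p) j) = p.2 0) :
    ∃ (Z : Set ((j : Fin m) → Fin (R j + 1) → ℝ))
      (S : Set ((Fin n → ℝ) × (ℕ → Fin m → ℝ))),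
      Z ∈ 𝓝 ((fun j (α : Fin (R j + 1)) =>
        φ ((shift f)^[(α : ℕ)]
          ((x₀, fun _ => u₀) : (Fin n → ℝ) × (ℕ → Fin m → ℝ))) j) :
        (j : Fin m) → Fin (R j + 1) → ℝ) ∧
      S ∈ 𝓝 ((x₀, fun _ => u₀) : (Fin n → ℝ) × (ℕ → Fin m → ℝ)) ∧
      ∀ Y : ℕ → Fin m → ℝ,
        (∀ k, (fun j (α : Fin (R j + 1)) => Y (k + α) j) ∈ Z) →
        -- existence: the trajectories obtained from the parametrization
        -- form a solution reproducing `Y`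
        ((∀ k, ((Fx fun j (α : Fin (R j)) => Y (k + α) j,
            fun i => Fu fun j (α : Fin (R j + 1)) => Y (k + i + α) j) :
            (Fin n → ℝ) × (ℕ → Fin m → ℝ)) ∈ S) ∧
         (∀ k, Fx (fun j (α : Fin (R j)) => Y (k + 1 + α) j)
            = f (Fx fun j (α : Fin (R j)) => Y (k + α) j)
                (Fu fun j (α : Fin (R j + 1)) => Y (k + α) j)) ∧
         (∀ k, φ (Fx fun j (α : Fin (R j)) => Y (k + α) j,
            fun i => Fu fun j (α : Fin (R j + 1)) => Y (k + i + α) j) = Y k)) ∧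
        -- uniqueness: any solution staying in `S` whose flat output is `Y`
        -- coincides with it
        (∀ (xs : ℕ → Fin n → ℝ) (us : ℕ → Fin m → ℝ),
          (∀ k, ((xs k, fun i => us (k + i)) :
            (Fin n → ℝ) × (ℕ → Fin m → ℝ)) ∈ S) →
          (∀ k, xs (k + 1) = f (xs k) (us k)) →
          (∀ k, φ (xs k, fun i => us (k + i)) = Y k) →
          ∀ k, xs k = Fx (fun j (α : Fin (R j)) => Y (k + α) j) ∧
            us k = Fu (fun j (α : Fin (R j + 1)) => Y (k + α) j)) := by
  set p₀ : (Fin n → ℝ) × (ℕ → Fin m → ℝ) := (x₀, fun _ => u₀)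
  have hfix : ∀ α : ℕ, (shift f)^[α] p₀ = p₀ := iterate_fixed (shift_fixed heq)
  obtain ⟨q, ψ, -, hψ⟩ := hflat.1
  set S : Set ((Fin n → ℝ) × (ℕ → Fin m → ℝ)) := {p |
    Fx (fun j (α : Fin (R j)) => φ ((shift f)^[(α : ℕ)] p) j) = p.1 ∧
      Fu (fun j (α : Fin (R j + 1)) => φ ((shift f)^[(α : ℕ)] p) j) = p.2 0}
  have hS : S ∈ 𝓝 p₀ := hpar
  let S' : Set ((Fin n → ℝ) × (ℕ → Fin m → ℝ)) :=
    {p | ∀ i : Fin (q + 2), (shift f)^[(i : ℕ)] p ∈ S}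
  have hS' : S' ∈ 𝓝 p₀ := by
    refine eventually_all.2 fun i => ?_
    have h := ((continuous_shift hf.continuous).iterate i).tendsto p₀
    rw [hfix] at h
    exact h.eventually_mem hS
  obtain ⟨r, hr⟩ : ∃ r, ∀ j, R j ≤ r :=
    ⟨Finset.univ.sup R, fun j => Finset.le_sup (Finset.mem_univ j)⟩
  let traj : (ℕ → Fin m → ℝ) → (Fin n → ℝ) × (ℕ → Fin m → ℝ) := fun z =>
    (Fx fun j (α : Fin (R j)) => z α j, fun i => Fu fun j (α : Fin (R j + 1)) => z (i + α) j)
  have htraj : Continuous traj := by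
    have h₁ := hFx.continuous
    have h₂ := hFu.continuous
    fun_prop
  have htraj₀ : traj (fun _ => φ p₀) = p₀ := by
    have h := hpar.self_of_nhds
    simp only [hfix] at h
    exact Prod.ext h.1 (funext fun _ => h.2)
  have hmem : ∀ᶠ z in 𝓝 (fun _ : ℕ => φ p₀), traj z ∈ S := by
    have h := htraj.tendsto fun _ => φ p₀
    rw [htraj₀] at h
    exact h.eventually_mem hS
  have hjet : ∀ᶠ z in 𝓝 (fun _ : ℕ => φ p₀), ∃ p ∈ S', ∀ α : Fin (q + r + 2),
      φ ((shift f)^[(α : ℕ)] p) = z α := by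
    have h : Continuous fun (z : ℕ → Fin m → ℝ) (α : Fin (q + r + 2)) => z α := by fun_prop
    exact (h.tendsto fun _ => φ p₀).eventually (hflat.eventually_exists_jet hf heq hS' (q + r + 2))
  have hsol : ∀ z : ℕ → Fin m → ℝ, (∃ p ∈ S', ∀ α : Fin (q + r + 2),
      φ ((shift f)^[(α : ℕ)] p) = z α) →
      Fx (fun j (α : Fin (R j)) => z (1 + α) j) = f (traj z).1 ((traj z).2 0) ∧
        φ (traj z) = z 0 := by
    rintro z ⟨p, hp, hpz⟩
    have hx : ∀ i : Fin (q + 2),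
        Fx (fun j (α : Fin (R j)) => z (i + α) j) = ((shift f)^[(i : ℕ)] p).1 := by
      intro i
      rw [← (hp i).1]
      congr 1
      funext j α
      have := hr j
      rw [← iterate_add_apply, add_comm (α : ℕ), ← hpz ⟨i + α, by omega⟩]
    have hu : ∀ i : Fin (q + 2), (traj z).2 i = p.2 i := by
      intro i
      rw [← zero_add (i : ℕ), ← snd_iterate_shift f p i 0, zero_add, ← (hp i).2]
      refine congrArg Fu ?_
      funext j α
      have := hr j
      rw [← iterate_add_apply, add_comm (α : ℕ), ← hpz ⟨i + α, by omega⟩]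
    have hx₀ : (traj z).1 = p.1 := by simpa [traj] using hx 0
    refine ⟨?_, ?_⟩
    · rw [hx₀, show (traj z).2 0 = p.2 0 from hu 0]
      exact hx 1
    · rw [show z 0 = φ p from (hpz 0).symm, hψ, hψ, hx₀]
      congr 2
      funext k
      exact hu ⟨k, by omega⟩
  obtain ⟨V, hV, hVP⟩ := exists_nhds_forall_of_eventually_nhds_const (hmem.and hjet)
  refine ⟨{w | (fun j => w j 0) ∈ V}, S, ?_, hS, fun Y hY => ⟨?_, ?_⟩⟩
  · have h : Continuous fun (w : (j : Fin m) → Fin (R j + 1) → ℝ) j => w j 0 := by fun_prop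
    refine (h.tendsto _).eventually_mem ?_
    simpa using hV
  · have hshift : ∀ k, traj (fun i => Y (k + i)) = (Fx fun j (α : Fin (R j)) => Y (k + α) j,
        fun i => Fu fun j (α : Fin (R j + 1)) => Y (k + i + α) j) := fun k => by
      simp only [traj, add_assoc]
    have hP : ∀ k, _ := fun k => hVP (fun i => Y (k + i)) fun i => by simpa using hY (k + i)
    refine ⟨fun k => hshift k ▸ (hP k).1, fun k => ?_, fun k => ?_⟩
    · have h := (hsol (fun i => Y (k + i)) (hP k).2).1
      rw [hshift] at h
      simpa [add_assoc] using h
    · have h := (hsol (fun i => Y (k + i)) (hP k).2).2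
      rwa [hshift] at h
  · intro xs us hxu hdyn hout k
    have hiter : ∀ α : ℕ, (shift f)^[α] (xs k, fun i => us (k + i))
        = (xs (k + α), fun i => us (k + α + i)) := by
      intro α
      induction α with
      | zero => rfl
      | succ α ih =>
        rw [iterate_succ_apply', ih]
        exact Prod.ext (hdyn (k + α)).symm (funext fun i => congrArg us (by omega))
    have h := hxu k
    simp only [S, Set.mem_ofPred_eq, hiter, hout] at h
    exact ⟨h.1.symm, h.2.symm⟩
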